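/- Let d = pq with p, q distinct primes, and let X, Y, Z be any three pairwise distinct sets chosen from the four sets A, B, C, D. Then KD⁺ ∩ span_ℝ(X ∪ Y ∪ Z) = ConvHull(X ∪ Y ∪ Z); that is, a density matrix is KD classical and lies in the real span of X ∪ Y ∪ Z if and only if it lies in the convex hull of X ∪ Y ∪ Z. -/

import Mathlib

open Complex Matrix
open scoped ComplexOrder

noncomputable section

/-- `omega n = exp(2 π i / n)`, a primitive `n`-th root of unity. -/
def omega (n : ℕ) : ℂ := Complex.exp (2 * Real.pi * Complex.I / n)

/-- The standard basis vector `a i` of `ℂ^d`. -/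
def stdVec (d : ℕ) (i : Fin d) : Fin d → ℂ := fun k => if k = i then 1 else 0

/-- The Fourier (DFT) basis vector `b j = (1/√d) ∑ i, ω_d^(i j) • a i`. -/
def fourierVec (d : ℕ) (j : Fin d) : Fin d → ℂ :=
  fun i => ((1 / Real.sqrt d : ℝ) : ℂ) * omega d ^ (i.val * j.val)

/-- The rank-one projector `|v⟩⟨v|` of a vector `v`, as a matrix. -/
def proj (d : ℕ) (v : Fin d → ℂ) : Matrix (Fin d) (Fin d) ℂ :=
  Matrix.of fun i k => v i * (starRingEnd ℂ) (v k)

/-- The Kirkwood-Dirac quasiprobability `Q i j F = ⟨b j|a i⟩ * ⟨a i|F|b j⟩`. -/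
def KDQ (d : ℕ) (F : Matrix (Fin d) (Fin d) ℂ) (i j : Fin d) : ℂ :=
  (starRingEnd ℂ) (fourierVec d j i) * ∑ k, F i k * fourierVec d j k

/-- The set `KD⁺` of KD classical density matrices: positive semidefinite, trace one,
and all KD quasiprobabilities are nonnegative reals. -/
def KDplus (d : ℕ) : Set (Matrix (Fin d) (Fin d) ℂ) :=
  {ρ | ρ.PosSemidef ∧ ρ.trace = 1 ∧
    ∀ i j, (KDQ d ρ i j).im = 0 ∧ 0 ≤ (KDQ d ρ i j).re}

/-- The set `KD^r` of self-adjoint operators whose KD distribution is everywhere real. -/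
def KDr (d : ℕ) : Set (Matrix (Fin d) (Fin d) ℂ) :=
  {F | F.IsHermitian ∧ ∀ i j, (KDQ d F i j).im = 0}

/-- `A = {|a i⟩⟨a i| : i ∈ ℤ_d}`. -/
def setA (d : ℕ) : Set (Matrix (Fin d) (Fin d) ℂ) :=
  {M | ∃ i : Fin d, M = proj d (stdVec d i)}

/-- `B = {|b j⟩⟨b j| : j ∈ ℤ_d}`. -/
def setB (d : ℕ) : Set (Matrix (Fin d) (Fin d) ℂ) :=
  {M | ∃ j : Fin d, M = proj d (fourierVec d j)}

/-- For `d = p * q` : `ψ m s = (1/√q) ∑ k ∈ ℤ_q, ω_q^(s k) • a (k p + m)`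
(so the `i`-th coordinate is nonzero iff `i ≡ m [MOD p]`, with `k = i / p`). -/
def psiPQ (d p q : ℕ) (m : Fin p) (s : Fin q) : Fin d → ℂ :=
  fun i => if i.val % p = m.val then
    ((1 / Real.sqrt q : ℝ) : ℂ) * omega q ^ (s.val * (i.val / p)) else 0

/-- For `d = p * q` : `φ m' s' = (1/√p) ∑ k ∈ ℤ_p, ω_p^(s' k) • a (k q + m')`. -/
def phiPQ (d p q : ℕ) (m' : Fin q) (s' : Fin p) : Fin d → ℂ :=
  fun i => if i.val % q = m'.val then
    ((1 / Real.sqrt p : ℝ) : ℂ) * omega p ^ (s'.val * (i.val / q)) else 0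

/-- For `d = p ^ 2` : `C = {|ψ m s⟩⟨ψ m s| : m, s ∈ ℤ_p}`. -/
def setC2 (d p : ℕ) : Set (Matrix (Fin d) (Fin d) ℂ) :=
  {M | ∃ m s : Fin p, M = proj d (psiPQ d p p m s)}

/-- For `d = p * q` : `C = {|ψ m s⟩⟨ψ m s| : m ∈ ℤ_p, s ∈ ℤ_q}`. -/
def setC (d p q : ℕ) : Set (Matrix (Fin d) (Fin d) ℂ) :=
  {M | ∃ (m : Fin p) (s : Fin q), M = proj d (psiPQ d p q m s)}

/-- For `d = p * q` : `D = {|φ m' s'⟩⟨φ m' s'| : m' ∈ ℤ_q, s' ∈ ℤ_p}`. -/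
def setD (d p q : ℕ) : Set (Matrix (Fin d) (Fin d) ℂ) :=
  {M | ∃ (m' : Fin q) (s' : Fin p), M = proj d (phiPQ d p q m' s')}

/-- Matrix entries in the Fourier basis: `⟨b k|G|b j⟩`. -/
def entryB (d : ℕ) (G : Matrix (Fin d) (Fin d) ℂ) (k j : Fin d) : ℂ :=
  ∑ i, ∑ l, (starRingEnd ℂ) (fourierVec d k i) * G i l * fourierVec d j l


section helpers

theorem abstract_path {V I K J P R S : Type*} [AddCommGroup V] [Module ℝ V]
    [Fintype I] [Fintype K] [Fintype J]
    [DecidableEq I] [DecidableEq K] [DecidableEq J]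
    (T : V →ₗ[ℝ] (P → ℂ)) (hT : Function.Injective T) (e : ℝ) (he : 0 < e)
    (X : I → V) (M : K → V) (Y : J → V) (x : P → I) (m : P → K) (y : P → J)
    (hX : ∀ i t, T (X i) t = if x t = i then (e : ℂ) else 0)
    (hM : ∀ i t, T (M i) t = if m t = i then (e : ℂ) else 0)
    (hY : ∀ i t, T (Y i) t = if y t = i then (e : ℂ) else 0)
    (f : I → R) (f' : K → R) (g : J → S) (g' : K → S)
    (hf : ∀ t, f (x t) = f' (m t)) (hg : ∀ t, g (y t) = g' (m t))
    (hsurj : Function.Surjective m)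
    (hc : ∀ i j k, f i = f' k → g j = g' k → ∃ t, x t = i ∧ y t = j ∧ m t = k)
    (a : I → ℝ) (c : K → ℝ) (b : J → ℝ)
    (hpos : ∀ t, 0 ≤ (T (∑ i, a i • X i + ∑ k, c k • M k + ∑ j, b j • Y j) t).re) :
    ∃ (a' : I → ℝ) (c' : K → ℝ) (b' : J → ℝ), (∀ i, 0 ≤ a' i) ∧ (∀ i, 0 ≤ c' i) ∧
      (∀ i, 0 ≤ b' i) ∧ ∑ i, a i • X i + ∑ k, c k • M k + ∑ j, b j • Y j =
        ∑ i, a' i • X i + ∑ k, c' k • M k + ∑ j, b' j • Y j := by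
  have key : ∀ (a : I → ℝ) (c : K → ℝ) (b : J → ℝ) (t : P),
      T (∑ i, a i • X i + ∑ k, c k • M k + ∑ j, b j • Y j) t =
        ((e * (a (x t) + c (m t) + b (y t)) : ℝ) : ℂ) := by
    intro a c b t
    simp only [map_add, map_sum, map_smul, Pi.add_apply, Finset.sum_apply, Pi.smul_apply,
      hX, hM, hY, smul_ite, smul_zero, Finset.sum_ite_eq, Finset.mem_univ, if_true,
      Complex.real_smul]
    push_cast
    ring
  have pos : ∀ t, 0 ≤ a (x t) + c (m t) + b (y t) := by
    intro t
    have h := hpos t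
    rw [key, Complex.ofReal_re] at h
    exact nonneg_of_mul_nonneg_right h he
  let α : R → ℝ := fun r => sInf (a '' {i | f i = r})
  let β : S → ℝ := fun s => sInf (b '' {j | g j = s})
  have hα : ∀ i, α (f i) ≤ a i := fun i =>
    csInf_le (Set.toFinite _).bddBelow ⟨i, rfl, rfl⟩
  have hβ : ∀ i, β (g i) ≤ b i := fun i =>
    csInf_le (Set.toFinite _).bddBelow ⟨i, rfl, rfl⟩
  have hα' : ∀ k, ∃ i, f i = f' k ∧ a i = α (f' k) := by
    intro k
    obtain ⟨t, rfl⟩ := hsurj k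
    have hne : (a '' {i | f i = f' (m t)}).Nonempty := ⟨_, x t, hf t, rfl⟩
    obtain ⟨i, hi, h⟩ := hne.csInf_mem (Set.toFinite _)
    exact ⟨i, hi, h⟩
  have hβ' : ∀ k, ∃ i, g i = g' k ∧ b i = β (g' k) := by
    intro k
    obtain ⟨t, rfl⟩ := hsurj k
    have hne : (b '' {i | g i = g' (m t)}).Nonempty := ⟨_, y t, hg t, rfl⟩
    obtain ⟨i, hi, h⟩ := hne.csInf_mem (Set.toFinite _)
    exact ⟨i, hi, h⟩
  refine ⟨fun i => a i - α (f i), fun k => c k + α (f' k) + β (g' k), fun j => b j - β (g j),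
    fun i => sub_nonneg.2 (hα i), ?_, fun j => sub_nonneg.2 (hβ j), ?_⟩
  · intro k
    obtain ⟨i, hi, hi'⟩ := hα' k
    obtain ⟨j, hj, hj'⟩ := hβ' k
    obtain ⟨t, rfl, rfl, rfl⟩ := hc i j k hi hj
    have := pos t
    simp only
    linarith
  · apply hT
    funext t
    rw [key, key, hf, hg]
    congr 2
    ring

theorem omega_prim (n : ℕ) (hn : n ≠ 0) : IsPrimitiveRoot (omega n) n :=
  Complex.isPrimitiveRoot_exp n hn

theorem omega_conj_mul (n : ℕ) (hn : n ≠ 0) (a : ℕ) :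
    (starRingEnd ℂ) (omega n ^ a) * omega n ^ a = 1 := by
  rw [mul_comm, Complex.mul_conj, Complex.normSq_eq_norm_sq, norm_pow,
    (omega_prim n hn).norm'_eq_one hn]
  simp

theorem omega_orth (n : ℕ) (hn : n ≠ 0) (a b : ℕ) :
    ∑ k : Fin n, (starRingEnd ℂ) (omega n ^ (a * k.val)) * omega n ^ (b * k.val) =
      if a % n = b % n then (n : ℂ) else 0 := by
  set z := (starRingEnd ℂ) (omega n ^ a) * omega n ^ b with hz
  have h1 : ∀ k : Fin n, (starRingEnd ℂ) (omega n ^ (a * k.val)) * omega n ^ (b * k.val) =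
      z ^ k.val := by
    intro k
    rw [hz, mul_pow, ← map_pow, ← pow_mul, ← pow_mul]
  have hzn : z ^ n = 1 := by
    rw [hz, mul_pow, ← map_pow, ← pow_mul, ← pow_mul, mul_comm a, mul_comm b, pow_mul, pow_mul,
      (omega_prim n hn).pow_eq_one]
    simp
  have hz1 : z = 1 ↔ a % n = b % n := by
    have h2 : z = 1 ↔ omega n ^ a = omega n ^ b := by
      constructor
      · intro h
        have h3 := omega_conj_mul n hn a
        have h4 : (starRingEnd ℂ) (omega n ^ a) ≠ 0 := left_ne_zero_of_mul_eq_one h3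
        apply mul_left_cancel₀ h4
        rw [h3, ← h]
      · intro h
        rw [hz, ← h, omega_conj_mul n hn]
    rw [h2]
    rw [((omega_prim n hn).isOfFinOrder hn).pow_eq_pow_iff_modEq, ← (omega_prim n hn).eq_orderOf]
    rfl
  rw [Finset.sum_congr rfl (fun k _ => h1 k), Fin.sum_univ_eq_sum_range (fun k => z ^ k) n]
  split_ifs with h
  · rw [hz1.2 h]; simp
  · have hne : z ≠ 1 := fun h' => h (hz1.1 h')
    rw [geom_sum_eq hne, hzn]; simp

theorem sum_mod {p q d : ℕ} (hp : 0 < p) (hd : d = q * p) (m : ℕ) (hm : m < p) (g : ℕ → ℂ) :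
    ∑ i : Fin d, (if i.val % p = m then g (i.val / p) else 0) = ∑ k : Fin q, g k.val := by
  subst hd
  rw [← finProdFinEquiv.sum_comp, Fintype.sum_prod_type]
  refine Finset.sum_congr rfl fun k _ => ?_
  rw [Finset.sum_eq_single (⟨m, hm⟩ : Fin p)]
  · simp [finProdFinEquiv, Nat.mod_eq_of_lt hm, Nat.add_mul_div_left _ _ hp,
      Nat.div_eq_of_lt hm]
  · intro b _ hb
    rw [if_neg]
    simp only [finProdFinEquiv, Equiv.coe_fn_mk, Nat.add_mul_mod_self_left,
      Nat.mod_eq_of_lt b.2]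
    exact fun h => hb (Fin.ext h)
  · simp

theorem sq_inv (d : ℕ) : ((1 / Real.sqrt d : ℝ) : ℂ) * ((1 / Real.sqrt d : ℝ) : ℂ) =
    (((1 / d : ℝ)) : ℂ) := by
  rw [← Complex.ofReal_mul]
  congr 1
  rw [div_mul_div_comm, Real.mul_self_sqrt (Nat.cast_nonneg d), one_mul]

theorem fourier_orth (d : ℕ) (hd : d ≠ 0) (l j : Fin d) :
    ∑ k, (starRingEnd ℂ) (fourierVec d l k) * fourierVec d j k = if j = l then 1 else 0 := by
  have h : ∀ k : Fin d, (starRingEnd ℂ) (fourierVec d l k) * fourierVec d j k =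
      (((1 / d : ℝ)) : ℂ) * ((starRingEnd ℂ) (omega d ^ (l.val * k.val)) *
        omega d ^ (j.val * k.val)) := by
    intro k
    rw [← sq_inv, fourierVec, fourierVec, map_mul, Complex.conj_ofReal, mul_comm k.val,
      mul_comm k.val]
    ring
  rw [Finset.sum_congr rfl (fun k _ => h k), ← Finset.mul_sum, omega_orth d hd,
    Nat.mod_eq_of_lt l.2, Nat.mod_eq_of_lt j.2]
  have hd' : (d : ℂ) ≠ 0 := by exact_mod_cast hd
  by_cases hjl : j = l
  · subst hjl; simp [hd']
  · rw [if_neg hjl, if_neg (fun h => hjl (Fin.ext h.symm)), mul_zero]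

theorem fourier_symm (d : ℕ) (l j : Fin d) : fourierVec d l j = fourierVec d j l := by
  simp [fourierVec, mul_comm]

/-- Real-linear map to the KD distribution. -/
def KDL (d : ℕ) : Matrix (Fin d) (Fin d) ℂ →ₗ[ℝ] (Fin d × Fin d → ℂ) where
  toFun F t := KDQ d F t.1 t.2
  map_add' F G := by
    funext t
    simp [KDQ, add_mul, Finset.sum_add_distrib, mul_add]
  map_smul' r F := by
    funext t
    simp only [KDQ, Matrix.smul_apply, Pi.smul_apply, Complex.real_smul, RingHom.id_apply,
      Finset.mul_sum]
    refine Finset.sum_congr rfl fun k _ => ?_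
    ring

theorem fourier_ne (d : ℕ) (hd : d ≠ 0) (i j : Fin d) :
    (starRingEnd ℂ) (fourierVec d j i) ≠ 0 := by
  rw [fourierVec, map_mul]
  refine mul_ne_zero ?_ (left_ne_zero_of_mul_eq_one (omega_conj_mul d hd _))
  have : Real.sqrt d ≠ 0 := Real.sqrt_ne_zero'.2 (by positivity)
  simp [hd]

theorem KDL_inv (d : ℕ) (hd : d ≠ 0) (F : Matrix (Fin d) (Fin d) ℂ) (i l : Fin d) :
    ∑ j, (starRingEnd ℂ) (fourierVec d j l) * ∑ k, F i k * fourierVec d j k = F i l := by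
  simp only [Finset.mul_sum]
  rw [Finset.sum_comm]
  have h : ∀ k, ∑ j, (starRingEnd ℂ) (fourierVec d j l) * (F i k * fourierVec d j k) =
      F i k * if k = l then 1 else 0 := by
    intro k
    rw [← fourier_orth d hd, Finset.mul_sum]
    refine Finset.sum_congr rfl fun j _ => ?_
    rw [fourier_symm d j l, fourier_symm d j k]
    ring
  simp [h]

theorem KDL_inj (d : ℕ) (hd : d ≠ 0) : Function.Injective (KDL d) := by
  rw [injective_iff_map_eq_zero]
  intro F hF
  ext i l
  rw [← KDL_inv d hd F i l]
  simp only [Matrix.zero_apply]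
  refine Finset.sum_eq_zero fun j _ => ?_
  have h : KDQ d F i j = 0 := congrFun hF (i, j)
  rw [KDQ, mul_eq_zero] at h
  rw [h.resolve_left (fourier_ne d hd i j), mul_zero]

theorem trace_eq (d : ℕ) (hd : d ≠ 0) (F : Matrix (Fin d) (Fin d) ℂ) :
    F.trace = ∑ i, ∑ j, KDQ d F i j := by
  simp only [KDQ, KDL_inv d hd]
  rfl

theorem KDQ_proj (d : ℕ) (v : Fin d → ℂ) (i j : Fin d) : KDQ d (proj d v) i j =
    (starRingEnd ℂ) (fourierVec d j i) * v i *
      ∑ k, (starRingEnd ℂ) (v k) * fourierVec d j k := by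
  simp [KDQ, proj, Finset.mul_sum, mul_assoc]

theorem conj_fourier (d : ℕ) (hd : d ≠ 0) (i j : Fin d) :
    (starRingEnd ℂ) (fourierVec d j i) * fourierVec d j i = ((1 / d : ℝ) : ℂ) := by
  rw [fourierVec, map_mul, Complex.conj_ofReal, ← sq_inv]
  have := omega_conj_mul d hd (i.val * j.val)
  linear_combination ((1 / Real.sqrt d : ℝ) : ℂ) * ((1 / Real.sqrt d : ℝ) : ℂ) * this

def fA (d : ℕ) (i : Fin d) := proj d (stdVec d i)
def fB (d : ℕ) (i : Fin d) := proj d (fourierVec d i)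
def fC (d p q : ℕ) (i : Fin p × Fin q) := proj d (psiPQ d p q i.1 i.2)

theorem setA_eq (d : ℕ) : setA d = Set.range (fA d) := by
  ext M; simp [setA, fA, eq_comm]
theorem setB_eq (d : ℕ) : setB d = Set.range (fB d) := by
  ext M; simp [setB, fB, eq_comm]
theorem setC_eq (d p q : ℕ) : setC d p q = Set.range (fC d p q) := by
  ext M; simp [setC, fC, eq_comm]
theorem setD_eq (d p q : ℕ) : setD d p q = setC d q p := rfl

theorem KD_A (d : ℕ) (hd : d ≠ 0) (i : Fin d) (t : Fin d × Fin d) :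
    KDL d (fA d i) t = if t.1 = i then ((1 / d : ℝ) : ℂ) else 0 := by
  change KDQ d (proj d _) t.1 t.2 = _
  rw [KDQ_proj]
  by_cases h : t.1 = i
  · subst h
    simp only [stdVec, if_true, apply_ite (starRingEnd ℂ), map_one, map_zero, ite_mul, one_mul,
      zero_mul, Finset.sum_ite_eq', Finset.mem_univ, mul_one]
    exact conj_fourier d hd _ _
  · simp [stdVec, h]

theorem KD_B (d : ℕ) (hd : d ≠ 0) (i : Fin d) (t : Fin d × Fin d) :
    KDL d (fB d i) t = if t.2 = i then ((1 / d : ℝ) : ℂ) else 0 := by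
  change KDQ d (proj d _) t.1 t.2 = _
  rw [KDQ_proj, fourier_orth d hd]
  by_cases h : t.2 = i
  · subst h
    rw [if_pos rfl, if_pos rfl, mul_one]
    exact conj_fourier d hd _ _
  · simp [h]

def iC (d p q : ℕ) (hp : 0 < p) (hq : 0 < q) (t : Fin d × Fin d) : Fin p × Fin q :=
  (⟨t.1.val % p, Nat.mod_lt _ hp⟩, ⟨t.2.val % q, Nat.mod_lt _ hq⟩)

theorem omega_mul_pow (d p q : ℕ) (hp : 0 < p) (hd : d = p * q) : omega d ^ p = omega q := by
  subst hd
  rw [omega, omega, ← Complex.exp_nat_mul]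
  congr 1
  have : (p : ℂ) ≠ 0 := by exact_mod_cast hp.ne'
  push_cast
  rw [mul_div_assoc', mul_div_mul_left _ _ this]

theorem psi_fourier (d p q : ℕ) (hp : 0 < p) (hq : 0 < q) (hd : d = p * q)
    (c : Fin p × Fin q) (j : Fin d) :
    ∑ k, (starRingEnd ℂ) (psiPQ d p q c.1 c.2 k) * fourierVec d j k =
      ((1 / Real.sqrt q : ℝ) : ℂ) * ((1 / Real.sqrt d : ℝ) : ℂ) * omega d ^ (c.1.val * j.val) *
        if j.val % q = c.2.val then (q : ℂ) else 0 := by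
  have h : ∀ k : Fin d, (starRingEnd ℂ) (psiPQ d p q c.1 c.2 k) * fourierVec d j k =
      if k.val % p = c.1.val then (fun n : ℕ => ((1 / Real.sqrt q : ℝ) : ℂ) *
        ((1 / Real.sqrt d : ℝ) : ℂ) * omega d ^ (c.1.val * j.val) *
        ((starRingEnd ℂ) (omega q ^ (c.2.val * n)) * omega q ^ (j.val * n))) (k.val / p)
      else 0 := by
    intro k
    unfold psiPQ
    split_ifs with hk
    · have h1 : omega d ^ (k.val * j.val) =
          omega d ^ (c.1.val * j.val) * omega q ^ (j.val * (k.val / p)) := by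
        rw [← omega_mul_pow d p q hp hd, ← pow_mul, ← pow_add]
        congr 1
        conv_lhs => rw [← Nat.mod_add_div k.val p, hk]
        ring
      rw [fourierVec, h1, map_mul, Complex.conj_ofReal]
      ring
    · simp
  rw [Finset.sum_congr rfl (fun k _ => h k)]
  refine (sum_mod hp (hd.trans (mul_comm _ _)) _ c.1.2
    (fun n : ℕ => ((1 / Real.sqrt q : ℝ) : ℂ) *
        ((1 / Real.sqrt d : ℝ) : ℂ) * omega d ^ (c.1.val * j.val) *
        ((starRingEnd ℂ) (omega q ^ (c.2.val * n)) * omega q ^ (j.val * n)))).trans ?_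
  rw [← Finset.mul_sum, omega_orth q hq.ne', Nat.mod_eq_of_lt c.2.2]
  simp only [eq_comm]

theorem KD_C (d p q : ℕ) (hp : 0 < p) (hq : 0 < q) (hd : d = p * q) (c : Fin p × Fin q)
    (t : Fin d × Fin d) :
    KDL d (fC d p q c) t = if iC d p q hp hq t = c then ((1 / d : ℝ) : ℂ) else 0 := by
  change KDQ d (proj d _) t.1 t.2 = _
  rw [KDQ_proj, psi_fourier d p q hp hq hd]
  have hd0 : d ≠ 0 := by subst hd; positivity
  by_cases h1 : t.1.val % p = c.1.val
  · by_cases h2 : t.2.val % q = c.2.val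
    · have h : iC d p q hp hq t = c := Prod.ext (Fin.ext h1) (Fin.ext h2)
      rw [if_pos h2, if_pos h, psiPQ, if_pos h1, fourierVec]
      have e1 := sq_inv q
      have e2 := sq_inv d
      have e3 := omega_conj_mul d hd0 (t.1.val * t.2.val)
      have e4 : omega d ^ (c.1.val * t.2.val) * omega q ^ (c.2.val * (t.1.val / p)) =
          omega d ^ (t.1.val * t.2.val) := by
        have e5 : omega q ^ (c.2.val * (t.1.val / p)) = omega q ^ (t.2.val * (t.1.val / p)) := by
          rw [pow_mul, pow_mul]
          congr 1
          rw [← h2]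
          conv_rhs => rw [← Nat.mod_add_div t.2.val q, pow_add, pow_mul,
            (omega_prim q hq.ne').pow_eq_one, one_pow, mul_one]
        rw [e5, ← omega_mul_pow d p q hp hd, ← pow_mul, ← pow_add]
        congr 1
        conv_rhs => rw [← Nat.mod_add_div t.1.val p, h1]
        ring
      have e6 : (((1 / q : ℝ)) : ℂ) * q = 1 := by
        have : (q : ℂ) ≠ 0 := by exact_mod_cast hq.ne'
        push_cast
        field_simp
      rw [map_mul, Complex.conj_ofReal]
      generalize ((1 / Real.sqrt q : ℝ) : ℂ) = u at *
      generalize ((1 / Real.sqrt d : ℝ) : ℂ) = v at *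
      generalize ((1 / q : ℝ) : ℂ) = w at *
      calc _ = (u * u) * q * (v * v) * ((starRingEnd ℂ) (omega d ^ (t.1.val * t.2.val)) *
            (omega d ^ (c.1.val * t.2.val) * omega q ^ (c.2.val * (t.1.val / p)))) := by ring
        _ = _ := by rw [e4, e3, e1, e2, e6]; ring
    · rw [if_neg h2, if_neg, mul_zero, mul_zero]
      rintro rfl
      exact h2 rfl
  · have h : ¬ iC d p q hp hq t = c := by
      rintro rfl
      exact h1 rfl
    rw [psiPQ, if_neg h1, if_neg h, mul_zero, zero_mul]

theorem proj_psd (d : ℕ) (v : Fin d → ℂ) : (proj d v).PosSemidef := by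
  have : proj d v = Matrix.vecMulVec v (star v) := by
    ext i j; simp [proj, Matrix.vecMulVec_apply]
  rw [this]
  exact Matrix.posSemidef_vecMulVec_self_star v

/-- A projector with flat KD distribution of the right count is in KD⁺. -/
theorem mem_KD (d : ℕ) (v : Fin d → ℂ) (htr : (proj d v).trace = 1)
    (Pr : Fin d × Fin d → Prop) [DecidablePred Pr]
    (h : ∀ t, KDL d (proj d v) t = if Pr t then ((1 / d : ℝ) : ℂ) else 0) :
    proj d v ∈ KDplus d := by
  refine ⟨proj_psd d v, htr, fun i j => ?_⟩
  have h' : KDQ d (proj d v) i j = _ := h (i, j)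
  rw [h']
  split_ifs
  · rw [Complex.ofReal_im, Complex.ofReal_re]
    exact ⟨rfl, by positivity⟩
  · simp

theorem A_sub (d : ℕ) (hd : d ≠ 0) : setA d ⊆ KDplus d := by
  rintro _ ⟨i, rfl⟩
  refine mem_KD d _ ?_ (fun t => t.1 = i) (KD_A d hd i)
  simp [Matrix.trace, proj, stdVec]

theorem B_sub (d : ℕ) (hd : d ≠ 0) : setB d ⊆ KDplus d := by
  rintro _ ⟨i, rfl⟩
  refine mem_KD d _ ?_ (fun t => t.2 = i) (KD_B d hd i)
  have := fourier_orth d hd i i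
  rw [if_pos rfl] at this
  rw [← this]
  simp [Matrix.trace, proj, mul_comm]

theorem C_sub (d p q : ℕ) (hp : 0 < p) (hq : 0 < q) (hd : d = p * q) :
    setC d p q ⊆ KDplus d := by
  rintro _ ⟨m, s, rfl⟩
  refine mem_KD d _ ?_ (fun t => iC d p q hp hq t = (m, s)) (KD_C d p q hp hq hd (m, s))
  have h : ∀ i : Fin d, psiPQ d p q m s i * (starRingEnd ℂ) (psiPQ d p q m s i) =
      if i.val % p = m.val then (fun _ : ℕ => ((1 / q : ℝ) : ℂ)) (i.val / p) else 0 := by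
    intro i
    unfold psiPQ
    split_ifs
    · have e := omega_conj_mul q hq.ne' (s.val * (i.val / p))
      rw [map_mul, Complex.conj_ofReal, ← sq_inv]
      linear_combination ((1 / Real.sqrt q : ℝ) : ℂ) * ((1 / Real.sqrt q : ℝ) : ℂ) * e
    · simp
  simp only [Matrix.trace, proj, Matrix.diag_apply, Matrix.of_apply]
  rw [Finset.sum_congr rfl (fun k _ => h k)]
  refine (sum_mod hp (hd.trans (mul_comm _ _)) _ m.2
    (fun _ : ℕ => ((1 / q : ℝ) : ℂ))).trans ?_
  have : (q : ℂ) ≠ 0 := by exact_mod_cast hq.ne'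
  simp [this]

theorem KDplus_convex (d : ℕ) : Convex ℝ (KDplus d) := by
  intro F hF G hG a b ha hb hab
  refine ⟨(hF.1.smul ha).add (hG.1.smul hb), ?_, fun i j => ?_⟩
  · rw [Matrix.trace_add, Matrix.trace_smul, Matrix.trace_smul, hF.2.1, hG.2.1, ← add_smul, hab,
      one_smul]
  · have h : KDQ d (a • F + b • G) i j = a • KDQ d F i j + b • KDQ d G i j := by
      have := congrFun (show KDL d (a • F + b • G) = a • KDL d F + b • KDL d G by simp) (i, j)
      exact this
    have hf := hF.2.2 i j
    have hg := hG.2.2 i j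
    rw [h]
    simp only [Complex.add_im, Complex.add_re, Complex.smul_im, Complex.smul_re, hf.1, hg.1,
      smul_eq_mul]
    exact ⟨by simp, add_nonneg (mul_nonneg ha hf.2) (mul_nonneg hb hg.2)⟩

theorem span_three {V I K J : Type*} [AddCommGroup V] [Module ℝ V]
    [Fintype I] [Fintype K] [Fintype J] (X : I → V) (M : K → V) (Y : J → V) (ρ : V)
    (hs : ρ ∈ Submodule.span ℝ (Set.range X ∪ Set.range M ∪ Set.range Y)) :
    ∃ (a : I → ℝ) (c : K → ℝ) (b : J → ℝ),
      ρ = ∑ i, a i • X i + ∑ k, c k • M k + ∑ j, b j • Y j := by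
  rw [Submodule.span_union, Submodule.span_union] at hs
  obtain ⟨w, hw, v, hv, h1⟩ := Submodule.mem_sup.1 hs
  obtain ⟨u, hu, z, hz, h2⟩ := Submodule.mem_sup.1 hw
  obtain ⟨a, ha⟩ := (Submodule.mem_span_range_iff_exists_fun ℝ).1 hu
  obtain ⟨c, hc⟩ := (Submodule.mem_span_range_iff_exists_fun ℝ).1 hz
  obtain ⟨b, hb⟩ := (Submodule.mem_span_range_iff_exists_fun ℝ).1 hv
  refine ⟨a, c, b, ?_⟩
  rw [ha, hc, hb, h2, h1]

theorem path_thm {I K J R S : Type*} [Fintype I] [Fintype K] [Fintype J]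
    [DecidableEq I] [DecidableEq K] [DecidableEq J] (d : ℕ) (hd : d ≠ 0)
    (X : I → Matrix (Fin d) (Fin d) ℂ) (M : K → Matrix (Fin d) (Fin d) ℂ)
    (Y : J → Matrix (Fin d) (Fin d) ℂ)
    (sX : Set.range X ⊆ KDplus d) (sM : Set.range M ⊆ KDplus d) (sY : Set.range Y ⊆ KDplus d)
    (x : Fin d × Fin d → I) (m : Fin d × Fin d → K) (y : Fin d × Fin d → J)
    (hX : ∀ i t, KDL d (X i) t = if x t = i then ((1 / d : ℝ) : ℂ) else 0)
    (hM : ∀ i t, KDL d (M i) t = if m t = i then ((1 / d : ℝ) : ℂ) else 0)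
    (hY : ∀ i t, KDL d (Y i) t = if y t = i then ((1 / d : ℝ) : ℂ) else 0)
    (f : I → R) (f' : K → R) (g : J → S) (g' : K → S)
    (hf : ∀ t, f (x t) = f' (m t)) (hg : ∀ t, g (y t) = g' (m t))
    (hsurj : Function.Surjective m)
    (hc : ∀ i j k, f i = f' k → g j = g' k → ∃ t, x t = i ∧ y t = j ∧ m t = k) :
    KDplus d ∩ (Submodule.span ℝ (Set.range X ∪ Set.range M ∪ Set.range Y) :
      Set (Matrix (Fin d) (Fin d) ℂ)) =
      convexHull ℝ (Set.range X ∪ Set.range M ∪ Set.range Y) := by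
  apply Set.Subset.antisymm
  · rintro ρ ⟨hρ, hs⟩
    obtain ⟨a, c, b, rfl⟩ := span_three X M Y ρ hs
    have hd1 : 0 < (1 / d : ℝ) := by positivity
    obtain ⟨a', c', b', ha, hc', hb, h⟩ := abstract_path (KDL d) (KDL_inj d hd) _ hd1 X M Y x m y
      hX hM hY f f' g g' hf hg hsurj hc a c b (fun t => (hρ.2.2 t.1 t.2).2)
    rw [h] at hρ ⊢
    have htr := hρ.2.1
    have tX : ∀ i, (X i).trace = 1 := fun i => (sX (Set.mem_range_self i)).2.1
    have tM : ∀ i, (M i).trace = 1 := fun i => (sM (Set.mem_range_self i)).2.1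
    have tY : ∀ i, (Y i).trace = 1 := fun i => (sY (Set.mem_range_self i)).2.1
    simp only [Matrix.trace_add, Matrix.trace_sum, Matrix.trace_smul, tX, tM, tY] at htr
    let wt : (I ⊕ K) ⊕ J → ℝ := Sum.elim (Sum.elim a' c') b'
    let pt : (I ⊕ K) ⊕ J → Matrix (Fin d) (Fin d) ℂ := Sum.elim (Sum.elim X M) Y
    have hsum : ∑ n, wt n • pt n =
        ∑ i, a' i • X i + ∑ k, c' k • M k + ∑ j, b' j • Y j := by
      simp [wt, pt, Fintype.sum_sum_type]
    rw [← hsum]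
    refine (convex_convexHull ℝ _).sum_mem ?_ ?_ ?_
    · rintro ((i | i) | i) _
      exacts [ha i, hc' i, hb i]
    · have : ((∑ n, wt n : ℝ) : ℂ) = 1 := by
        rw [← htr]
        simp [wt, Fintype.sum_sum_type]
      exact_mod_cast this
    · rintro ((i | i) | i) _
      · exact subset_convexHull ℝ _ (Or.inl (Or.inl ⟨i, rfl⟩))
      · exact subset_convexHull ℝ _ (Or.inl (Or.inr ⟨i, rfl⟩))
      · exact subset_convexHull ℝ _ (Or.inr ⟨i, rfl⟩)
  · apply Set.subset_inter
    · exact convexHull_min (Set.union_subset (Set.union_subset sX sM) sY) (KDplus_convex d)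
    · exact convexHull_min Submodule.subset_span (Submodule.convex _)

theorem crt (d p q : ℕ) (hp : 0 < p) (hq : 0 < q) (hpq : p.Coprime q) (hd : d = p * q)
    (a : Fin p) (b : Fin q) : ∃ i : Fin d, i.val % p = a.val ∧ i.val % q = b.val := by
  obtain ⟨k, h1, h2⟩ := Nat.chineseRemainder hpq a.val b.val
  refine ⟨⟨k % d, Nat.mod_lt _ (by subst hd; positivity)⟩, ?_, ?_⟩
  · subst hd
    simp only [Nat.mod_mul_right_mod]
    exact Eq.trans h1 (Nat.mod_eq_of_lt a.2)
  · subst hd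
    simp only [Nat.mod_mul_left_mod]
    exact Eq.trans h2 (Nat.mod_eq_of_lt b.2)

theorem iC_surj (d p q : ℕ) (hp : 0 < p) (hq : 0 < q) (hd : d = p * q) :
    Function.Surjective (iC d p q hp hq) := by
  rintro ⟨m, s⟩
  have h1 : m.val < d := by subst hd; exact lt_of_lt_of_le m.2 (Nat.le_mul_of_pos_right _ hq)
  have h2 : s.val < d := by subst hd; exact lt_of_lt_of_le s.2 (Nat.le_mul_of_pos_left _ hp)
  refine ⟨(⟨m, h1⟩, ⟨s, h2⟩), Prod.ext (Fin.ext ?_) (Fin.ext ?_)⟩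
  · exact Nat.mod_eq_of_lt m.2
  · exact Nat.mod_eq_of_lt s.2

theorem case_ACB (d p q : ℕ) (hp : 0 < p) (hq : 0 < q) (hd : d = p * q) :
    KDplus d ∩ (Submodule.span ℝ (setA d ∪ setC d p q ∪ setB d) :
      Set (Matrix (Fin d) (Fin d) ℂ)) = convexHull ℝ (setA d ∪ setC d p q ∪ setB d) := by
  have hd0 : d ≠ 0 := by subst hd; positivity
  have hA := A_sub d hd0
  have hB := B_sub d hd0
  have hC := C_sub d p q hp hq hd
  rw [setA_eq] at *
  rw [setB_eq] at *
  rw [setC_eq] at *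
  refine path_thm d hd0 _ _ _ hA hC hB Prod.fst (iC d p q hp hq) Prod.snd (KD_A d hd0)
    (KD_C d p q hp hq hd) (KD_B d hd0) (fun i => i.val % p) (fun c => c.1.val)
    (fun j => j.val % q) (fun c => c.2.val) (fun _ => rfl) (fun _ => rfl)
    (iC_surj d p q hp hq hd) ?_
  intro i j k h1 h2
  exact ⟨(i, j), rfl, rfl, Prod.ext (Fin.ext h1) (Fin.ext h2)⟩

theorem case_CAD (d p q : ℕ) (hp : 0 < p) (hq : 0 < q) (hpq : p.Coprime q) (hd : d = p * q) :
    KDplus d ∩ (Submodule.span ℝ (setC d p q ∪ setA d ∪ setC d q p) :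
      Set (Matrix (Fin d) (Fin d) ℂ)) = convexHull ℝ (setC d p q ∪ setA d ∪ setC d q p) := by
  have hd0 : d ≠ 0 := by subst hd; positivity
  have hd' : d = q * p := hd.trans (mul_comm _ _)
  have hA := A_sub d hd0
  have hC := C_sub d p q hp hq hd
  have hD := C_sub d q p hq hp hd'
  rw [setA_eq] at *
  rw [setC_eq] at hC hD ⊢
  rw [setC_eq]
  refine path_thm d hd0 _ _ _ hC hA hD (iC d p q hp hq) Prod.fst (iC d q p hq hp)
    (KD_C d p q hp hq hd) (KD_A d hd0) (KD_C d q p hq hp hd') (fun c => c.1.val)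
    (fun i => i.val % p) (fun c => c.1.val) (fun i => i.val % q) (fun _ => rfl) (fun _ => rfl)
    (fun i => ⟨(i, i), rfl⟩) ?_
  intro c e i h1 h2
  obtain ⟨j, hj1, hj2⟩ := crt d p q hp hq hpq hd e.2 c.2
  exact ⟨(i, j), Prod.ext (Fin.ext h1.symm) (Fin.ext hj2),
    Prod.ext (Fin.ext h2.symm) (Fin.ext hj1), rfl⟩

theorem case_CBD (d p q : ℕ) (hp : 0 < p) (hq : 0 < q) (hpq : p.Coprime q) (hd : d = p * q) :
    KDplus d ∩ (Submodule.span ℝ (setC d p q ∪ setB d ∪ setC d q p) :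
      Set (Matrix (Fin d) (Fin d) ℂ)) = convexHull ℝ (setC d p q ∪ setB d ∪ setC d q p) := by
  have hd0 : d ≠ 0 := by subst hd; positivity
  have hd' : d = q * p := hd.trans (mul_comm _ _)
  have hB := B_sub d hd0
  have hC := C_sub d p q hp hq hd
  have hD := C_sub d q p hq hp hd'
  rw [setB_eq] at *
  rw [setC_eq] at hC hD ⊢
  rw [setC_eq]
  refine path_thm d hd0 _ _ _ hC hB hD (iC d p q hp hq) Prod.snd (iC d q p hq hp)
    (KD_C d p q hp hq hd) (KD_B d hd0) (KD_C d q p hq hp hd') (fun c => c.2.val)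
    (fun i => i.val % q) (fun c => c.2.val) (fun i => i.val % p) (fun _ => rfl) (fun _ => rfl)
    (fun i => ⟨(i, i), rfl⟩) ?_
  intro c e j h1 h2
  obtain ⟨i, hi1, hi2⟩ := crt d p q hp hq hpq hd c.1 e.1
  exact ⟨(i, j), Prod.ext (Fin.ext hi1) (Fin.ext h1.symm),
    Prod.ext (Fin.ext hi2) (Fin.ext h2.symm), rfl⟩

end helpers

/-- For `d = pq` with `p, q` distinct primes and `X, Y, Z` any three
pairwise distinct sets among `A, B, C, D`,
`KD⁺ ∩ span_ℝ(X ∪ Y ∪ Z) = ConvHull(X ∪ Y ∪ Z)`. -/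
theorem stmt11 (p q d : ℕ) (hp : p.Prime) (hq : q.Prime) (hpq : p ≠ q)
    (hd : d = p * q) (X Y Z : Set (Matrix (Fin d) (Fin d) ℂ))
    (hX : X ∈ ({setA d, setB d, setC d p q, setD d p q} :
      Set (Set (Matrix (Fin d) (Fin d) ℂ))))
    (hY : Y ∈ ({setA d, setB d, setC d p q, setD d p q} :
      Set (Set (Matrix (Fin d) (Fin d) ℂ))))
    (hZ : Z ∈ ({setA d, setB d, setC d p q, setD d p q} :
      Set (Set (Matrix (Fin d) (Fin d) ℂ))))
    (hXY : X ≠ Y) (hXZ : X ≠ Z) (hYZ : Y ≠ Z) :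
    KDplus d ∩ (Submodule.span ℝ (X ∪ Y ∪ Z) : Set (Matrix (Fin d) (Fin d) ℂ)) =
      convexHull ℝ (X ∪ Y ∪ Z) := by
  have hcop : p.Coprime q := (Nat.coprime_primes hp hq).2 hpq
  have hd' : d = q * p := hd.trans (mul_comm _ _)
  have h1 := case_ACB d p q hp.pos hq.pos hd
  have h2 := case_ACB d q p hq.pos hp.pos hd'
  have h3 := case_CAD d p q hp.pos hq.pos hcop hd
  have h4 := case_CBD d p q hp.pos hq.pos hcop hd
  rw [setD_eq] at hX hY hZ
  simp only [Set.mem_insert_iff, Set.mem_singleton_iff] at hX hY hZ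
  generalize setA d = A at *
  generalize setB d = B at *
  generalize setC d p q = C at *
  generalize setC d q p = D at *
  have fin : ∀ W U : Set (Matrix (Fin d) (Fin d) ℂ), W = U →
      KDplus d ∩ (Submodule.span ℝ U : Set (Matrix (Fin d) (Fin d) ℂ)) = convexHull ℝ U →
      KDplus d ∩ (Submodule.span ℝ W : Set (Matrix (Fin d) (Fin d) ℂ)) = convexHull ℝ W := by
    rintro W _ rfl h
    exact h
  clear hd hd'
  rcases hX with rfl | rfl | rfl | rfl <;> rcases hY with h | h | h | h <;>
    first
    | exact absurd h.symm hXY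
    | (rcases hZ with h' | h' | h' | h' <;>
        first
        | exact absurd h'.symm hXZ
        | exact absurd (h.trans h'.symm) hYZ
        | (rw [h, h']
           first
           | exact fin _ _ (by ac_rfl) h1
           | exact fin _ _ (by ac_rfl) h2
           | exact fin _ _ (by ac_rfl) h3
           | exact fin _ _ (by ac_rfl) h4))
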